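/- A two-player two-action game with payoff matrix M = ((a,A),(b,B);(c,C),(d,D)) is a game with repercussion utilities (i.e. arises as the repercussion-utility companion of some allocation game) if and only if a = A + b − C and d = D + c − B. -/

import Mathlib

/-- The load of action `i` under a pure action profile `s`. -/
def gload {P Act : Type*} [Fintype P] [DecidableEq P] [DecidableEq Act]
    (s : P → Act) (i : Act) : Finset P :=
  Finset.univ.filter (fun m => s m = i)

/-- The repercussion utility of player `n` under the profile `s` in an allocation game
whose payoff `u n i L` depends on the player `n`, the chosen action `i` and the load
`L` on that action:
`r_n(s) = u_n(ℓ^{s_n}(s)) − Σ_{m≠n : s_m=s_n} (u_m(ℓ^{s_m}(s) − e_n) − u_m(ℓ^{s_m}(s)))`. -/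
def repAct {P Act : Type*} [Fintype P] [DecidableEq P] [DecidableEq Act]
    (u : P → Act → Finset P → ℝ) (s : P → Act) (n : P) : ℝ :=
  u n (s n) (gload s (s n)) -
    ∑ m ∈ (gload s (s n)).erase n,
      (u m (s n) ((gload s (s n)).erase n) - u m (s n) (gload s (s n)))

/-- The two-player profile where player `0` plays `i` and player `1` plays `j`. -/
def prof2 (i j : Fin 2) : Fin 2 → Fin 2 := fun m => if m = 0 then i else j

/-- the two-player two-action game with payoff matrix
`M = ((a,A),(b,B);(c,C),(d,D))` (player 1 chooses the row, player 2 the column) is a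
game with repercussion utilities — i.e. it arises as the repercussion-utility companion
of some allocation game — if and only if `a = A + b − C` and `d = D + c − B`. -/
theorem two_by_two_repercussion_characterization (a A b B c C d D : ℝ) :
    (∃ u : Fin 2 → Fin 2 → Finset (Fin 2) → ℝ,
        repAct u (prof2 0 0) 0 = a ∧ repAct u (prof2 0 0) 1 = A ∧
        repAct u (prof2 0 1) 0 = b ∧ repAct u (prof2 0 1) 1 = B ∧
        repAct u (prof2 1 0) 0 = c ∧ repAct u (prof2 1 0) 1 = C ∧
        repAct u (prof2 1 1) 0 = d ∧ repAct u (prof2 1 1) 1 = D) ↔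
      (a = A + b - C ∧ d = D + c - B) := by
  have e0 : ({0, 1} : Finset (Fin 2)).erase 0 = {1} := by decide
  have e1 : ({0, 1} : Finset (Fin 2)).erase 1 = {0} := by decide
  have f0 : ({0} : Finset (Fin 2)).erase 0 = ∅ := by decide
  have f1 : ({1} : Finset (Fin 2)).erase 1 = ∅ := by decide
  have l00 : gload (prof2 0 0) 0 = {0, 1} := by decide
  have l11 : gload (prof2 1 1) 1 = {0, 1} := by decide
  have l010 : gload (prof2 0 1) 0 = {0} := by decide
  have l011 : gload (prof2 0 1) 1 = {1} := by decide
  have l100 : gload (prof2 1 0) 0 = {1} := by decide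
  have l101 : gload (prof2 1 0) 1 = {0} := by decide
  have p0 : ∀ i j : Fin 2, prof2 i j 0 = i := by decide
  have p1 : ∀ i j : Fin 2, prof2 i j 1 = j := by decide
  have n1 : ({0, 1} : Finset (Fin 2)) ≠ {0} := by decide
  have n2 : ({0, 1} : Finset (Fin 2)) ≠ {1} := by decide
  simp only [repAct, p0, p1, l00, l11, l010, l011, l100, l101, e0, e1, f0, f1,
    Finset.sum_singleton, Finset.sum_empty, sub_zero]
  constructor
  · rintro ⟨u, h1, h2, h3, h4, h5, h6, h7, h8⟩
    constructor <;> linarith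
  · rintro ⟨h, h'⟩
    refine ⟨fun n i L => if n = 0 then
        (if L = {0} then (if i = 0 then b else c) else (if i = 0 then a + C else d + B))
      else (if L = {1} then (if i = 0 then C else B) else 0), ?_⟩
    simp only [n1, n2, if_true, if_false, one_ne_zero]
    refine ⟨?_, ?_, ?_, ?_, ?_, ?_, ?_, ?_⟩ <;> first | trivial | linarith
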